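/- Let g be a signature of arity n. Every arity-0 signature (scalar) in the ≠₂-diagram closure of g equals 0 if and only if g is an EO> signature or an EO< signature (i.e., either every string in supp(g) has strictly more 1s than 0s, or every string in supp(g) has strictly fewer 1s than 0s). This characterizes the vanishing signatures: a signature f is vanishing (all Holant instances over f evaluate to 0) exactly when ĝ = K⁻¹f is EO> or EO<. -/

import Mathlib

/-- Number of `1`s (Hamming weight) of a Boolean string. -/
def wt1 {n : ℕ} (x : Fin n → Bool) : ℕ := (Finset.univ.filter fun i => x i = true).card

/-- Number of `0`s of a Boolean string. -/
def wt0 {n : ℕ} (x : Fin n → Bool) : ℕ := (Finset.univ.filter fun i => x i = false).card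

/-- The tensor product of two signatures: `(x,y) ↦ f(x)·g(y)`. -/
noncomputable def tensorSig {a b : ℕ} (f : (Fin a → Bool) → ℂ) (g : (Fin b → Bool) → ℂ) :
    (Fin (a + b) → Bool) → ℂ :=
  fun x => f (fun i => x (Fin.castAdd b i)) * g (fun j => x (Fin.natAdd a j))

/-- The `≠₂`-self-loop of a signature `f` of arity `n+2`, connecting the
variable at position `i` with the variable at position `j` among the remaining
ones: `x ↦ f(x with xᵢ=0, xⱼ=1) + f(x with xᵢ=1, xⱼ=0)`. -/
noncomputable def selfLoop {n : ℕ} (f : (Fin (n + 2) → Bool) → ℂ)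
    (i : Fin (n + 2)) (j : Fin (n + 1)) : (Fin n → Bool) → ℂ :=
  fun x => f (i.insertNth false (j.insertNth true x)) +
    f (i.insertNth true (j.insertNth false x))

/-- The `≠₂`-diagram closure of `g`: the smallest class of signatures
containing `g` and closed under tensor products of two members and under
`≠₂`-self-loops. -/
inductive DClosure (n : ℕ) (g : (Fin n → Bool) → ℂ) :
    (m : ℕ) → ((Fin m → Bool) → ℂ) → Prop
  | base : DClosure n g n g
  | tensor {a b : ℕ} {f₁ : (Fin a → Bool) → ℂ} {f₂ : (Fin b → Bool) → ℂ}
      (h₁ : DClosure n g a f₁) (h₂ : DClosure n g b f₂) :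
      DClosure n g (a + b) (tensorSig f₁ f₂)
  | loop {m : ℕ} {f : (Fin (m + 2) → Bool) → ℂ}
      (h : DClosure n g (m + 2) f) (i : Fin (m + 2)) (j : Fin (m + 1)) :
      DClosure n g m (selfLoop f i j)

namespace VanSig

/-- signed weight: number of ones minus number of zeros -/
def sw {n : ℕ} (x : Fin n → Bool) : ℤ := ∑ i, (if x i = true then (1 : ℤ) else -1)

lemma sw_eq {n : ℕ} (x : Fin n → Bool) : sw x = (wt1 x : ℤ) - wt0 x := by
  unfold sw wt1 wt0
  rw [Finset.card_filter, Finset.card_filter]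
  push_cast
  rw [← Finset.sum_sub_distrib]
  refine Finset.sum_congr rfl fun i _ => ?_
  cases x i <;> simp

lemma sw_insert {n : ℕ} (i : Fin (n + 1)) (b : Bool) (x : Fin n → Bool) :
    sw (i.insertNth b x) = (if b = true then (1 : ℤ) else -1) + sw x := by
  unfold sw
  rw [Fin.sum_univ_succAbove _ i]
  simp

lemma sw_not {n : ℕ} (x : Fin n → Bool) : sw (fun i => !x i) = - sw x := by
  unfold sw
  rw [← Finset.sum_neg_distrib]
  refine Finset.sum_congr rfl fun i _ => ?_
  cases h : x i <;> simp [h]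

lemma sw_perm {n : ℕ} (x : Fin n → Bool) (e : Equiv.Perm (Fin n)) :
    sw (fun i => x (e i)) = sw x := by
  unfold sw
  exact Equiv.sum_comp e (fun i => if x i = true then (1 : ℤ) else -1)

lemma sw_add {a b : ℕ} (x : Fin (a + b) → Bool) :
    sw x = sw (fun i => x (Fin.castAdd b i)) + sw (fun j => x (Fin.natAdd a j)) := by
  unfold sw
  rw [Fin.sum_univ_add]

lemma pos_of_closure {n : ℕ} {g : (Fin n → Bool) → ℂ}
    (hg : ∀ α, g α ≠ 0 → 0 < sw α) {m : ℕ} {F : (Fin m → Bool) → ℂ}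
    (h : DClosure n g m F) : ∀ α, F α ≠ 0 → 0 < sw α := by
  induction h with
  | base => exact hg
  | tensor h₁ h₂ ih₁ ih₂ =>
    intro α hα
    unfold tensorSig at hα
    have := ih₁ _ (left_ne_zero_of_mul hα)
    have := ih₂ _ (right_ne_zero_of_mul hα)
    rw [sw_add]; omega
  | loop h i j ih =>
    intro α hα
    unfold selfLoop at hα
    by_contra hc
    apply hα
    rw [not_lt] at hc
    rw [not_imp_comm.mp (ih (i.insertNth false (j.insertNth true α))),
      not_imp_comm.mp (ih (i.insertNth true (j.insertNth false α))), add_zero]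
    · simp [sw_insert]; omega
    · simp [sw_insert]; omega

lemma neg_of_closure {n : ℕ} {g : (Fin n → Bool) → ℂ}
    (hg : ∀ α, g α ≠ 0 → sw α < 0) {m : ℕ} {F : (Fin m → Bool) → ℂ}
    (h : DClosure n g m F) : ∀ α, F α ≠ 0 → sw α < 0 := by
  induction h with
  | base => exact hg
  | tensor h₁ h₂ ih₁ ih₂ =>
    intro α hα
    unfold tensorSig at hα
    have := ih₁ _ (left_ne_zero_of_mul hα)
    have := ih₂ _ (right_ne_zero_of_mul hα)
    rw [sw_add]; omega
  | loop h i j ih =>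
    intro α hα
    unfold selfLoop at hα
    by_contra hc
    apply hα
    rw [not_lt] at hc
    rw [not_imp_comm.mp (ih (i.insertNth false (j.insertNth true α))),
      not_imp_comm.mp (ih (i.insertNth true (j.insertNth false α))), add_zero]
    · simp [sw_insert]; omega
    · simp [sw_insert]; omega

/-- symmetrization under complement -/
noncomputable def S {m : ℕ} (F : (Fin m → Bool) → ℂ) (x : Fin m → Bool) : ℂ :=
  F x + F (fun i => !x i)

lemma S_not {m : ℕ} (F : (Fin m → Bool) → ℂ) (x : Fin m → Bool) :
    S F (fun i => !x i) = S F x := by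
  simp [S, add_comm]

lemma eq_insert {m : ℕ} (y : Fin (m + 2) → Bool) (p : Fin (m + 2)) (j : Fin (m + 1)) :
    y = p.insertNth (y p) (j.insertNth (y (p.succAbove j))
      (fun k => y (p.succAbove (j.succAbove k)))) := by
  funext i
  induction i using Fin.succAboveCases p with
  | x => simp
  | p i =>
    induction i using Fin.succAboveCases j with
    | x => simp
    | p i => simp

lemma swap_aux {m : ℕ} (F : (Fin (m + 2) → Bool) → ℂ)
    (ih : ∀ i j, ∀ x, sw x = 0 → S (selfLoop F i j) x = 0)
    (y : Fin (m + 2) → Bool) (hy : sw y = 0) (p q : Fin (m + 2))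
    (hpq : y p ≠ y q) : S F y + S F (fun i => y (Equiv.swap p q i)) = 0 := by
  have hne : q ≠ p := fun h => hpq (by rw [h])
  obtain ⟨j, rfl⟩ := Fin.exists_succAbove_eq hne
  set x : Fin m → Bool := fun k => y (p.succAbove (j.succAbove k)) with hx
  have e1 := eq_insert y p j
  have e2 := eq_insert (fun i => y (Equiv.swap p (p.succAbove j) i)) p j
  have e3 := eq_insert (fun i => !y i) p j
  have e4 := eq_insert (fun i => !y (Equiv.swap p (p.succAbove j) i)) p j
  have hk : ∀ k, Equiv.swap p (p.succAbove j) (p.succAbove (j.succAbove k))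
      = p.succAbove (j.succAbove k) := fun k =>
    Equiv.swap_apply_of_ne_of_ne (Fin.succAbove_ne _ _)
      (fun h => Fin.succAbove_ne j k (Fin.succAbove_right_injective h))
  simp only [hk, Equiv.swap_apply_left, Equiv.swap_apply_right] at e2 e4
  have hw : sw x = 0 := by
    have := hy
    rw [e1, sw_insert, sw_insert] at this
    revert this hpq
    cases y p <;> cases y (p.succAbove j) <;> simp [← hx]
  have := ih p j x hw
  unfold S selfLoop at this
  unfold S
  rw [congrArg F e4, congrArg F e2, congrArg F e3, congrArg F e1]
  simp only [hx] at this
  clear e1 e2 e3 e4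
  revert hpq
  cases y p <;> cases y (p.succAbove j) <;> intro hpq <;>
    first
    | exact absurd rfl hpq
    | (simp only [Bool.not_true, Bool.not_false]; linear_combination this)

lemma exists_val {m : ℕ} (y : Fin (m + 1) → Bool) (hy : sw y = 0) (b : Bool) :
    ∃ p, y p = b := by
  by_contra! h
  unfold sw at hy
  have h' : ∀ p, y p = !b := fun p => by have := h p; cases b <;> simp_all
  simp only [h'] at hy
  cases b <;> simp at hy <;> omega

lemma S_zero {n : ℕ} {g : (Fin n → Bool) → ℂ}
    (H : ∀ h : (Fin 0 → Bool) → ℂ, DClosure n g 0 h → h (fun i => i.elim0) = 0) :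
    ∀ (m : ℕ) (F : (Fin m → Bool) → ℂ), DClosure n g m F → ∀ y, sw y = 0 → S F y = 0
  | 0, F, hF, y, _ => by
    have h0 := H F hF
    have h1 : ∀ z, F z = 0 := fun z => by rw [← h0]; congr 1; exact Subsingleton.elim _ _
    simp [S, h1]
  | 1, F, hF, y, hy => by
    exfalso
    unfold sw at hy
    simp at hy
    split_ifs at hy <;> omega
  | m + 2, F, hF, y, hy => by
    have T := swap_aux F (fun i j x hx => S_zero H m _ (DClosure.loop hF i j) x hx)
    obtain ⟨p, hp⟩ := exists_val y hy false
    obtain ⟨q, hq⟩ := exists_val y hy true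
    have hne : p ≠ q := fun h => by rw [h, hq] at hp; cases hp
    by_cases hb : ∃ b, b ≠ p ∧ b ≠ q
    · obtain ⟨b, hbp, hbq⟩ := hb
      have key : ∀ u v w : Fin (m + 2), u ≠ v → u ≠ w → v ≠ w → y u = y v → y u ≠ y w →
          S F y = 0 := by
        intro u v w huv huw hvw h1 h2
        have t1 := T y hy u w h2
        set y1 : Fin (m + 2) → Bool := fun i => y (Equiv.swap u w i) with hy1
        have s1 : sw y1 = 0 := by rw [hy1, sw_perm, hy]
        have a1 : y1 u = y w := by simp [hy1]
        have a2 : y1 v = y u := by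
          simp [hy1, Equiv.swap_apply_of_ne_of_ne huv.symm hvw, h1]
        have a3 : y1 w = y u := by simp [hy1]
        have t2 := T y1 s1 u v (by rw [a1, a2]; exact h2.symm)
        set y2 : Fin (m + 2) → Bool := fun i => y1 (Equiv.swap u v i) with hy2
        have s2 : sw y2 = 0 := by rw [hy2, sw_perm, s1]
        have b1 : y2 u = y u := by simp [hy2, a2]
        have b2 : y2 v = y w := by simp [hy2, a1]
        have b3 : y2 w = y u := by
          simp [hy2, Equiv.swap_apply_of_ne_of_ne huw.symm hvw.symm, a3]
        have t3 := T y2 s2 v w (by rw [b2, b3]; exact h2.symm)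
        have e : (fun i => y2 (Equiv.swap v w i)) = y := by
          funext i
          by_cases iu : i = u
          · subst iu; rw [Equiv.swap_apply_of_ne_of_ne huv huw, b1]
          by_cases iv : i = v
          · subst iv; rw [Equiv.swap_apply_left, b3, h1]
          by_cases iw : i = w
          · subst iw; rw [Equiv.swap_apply_right, b2]
          · rw [Equiv.swap_apply_of_ne_of_ne iv iw, hy2]
            simp only [Equiv.swap_apply_of_ne_of_ne iu iv, hy1,
              Equiv.swap_apply_of_ne_of_ne iu iw]
        rw [e] at t3
        linear_combination (1 / 2) * (t1 - t2 + t3)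
      cases hyb : y b
      · exact key p b q hbp.symm hne hbq (by rw [hp, hyb]) (by simp [hp, hq])
      · exact key q b p hbq.symm hne.symm hbp (by rw [hq, hyb]) (by simp [hp, hq])
    · push Not at hb
      have t := T y hy p q (by simp [hp, hq])
      have e : (fun i => y (Equiv.swap p q i)) = fun i => !y i := by
        funext i
        by_cases ip : i = p
        · subst ip; simp [hp, hq]
        · have := hb i ip
          subst this; simp [hp, hq]
      rw [e, S_not] at t
      linear_combination (1 / 2) * t

/-- some member of the closure has a support string of signed weight `w` -/
def R {n : ℕ} (g : (Fin n → Bool) → ℂ) (w : ℤ) : Prop :=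
  ∃ (m : ℕ) (F : (Fin m → Bool) → ℂ) (y : Fin m → Bool), DClosure n g m F ∧ F y ≠ 0 ∧ sw y = w

lemma R_add {n : ℕ} {g : (Fin n → Bool) → ℂ} {a b : ℤ} (ha : R g a) (hb : R g b) :
    R g (a + b) := by
  obtain ⟨m, F, y, hF, hy, rfl⟩ := ha
  obtain ⟨m', F', y', hF', hy', rfl⟩ := hb
  refine ⟨_, _, Fin.append y y', DClosure.tensor hF hF', ?_, ?_⟩
  · simp [tensorSig, hy, hy']
  · rw [sw_add]; simp

lemma R_mul {n : ℕ} {g : (Fin n → Bool) → ℂ} {a : ℤ} (ha : R g a) (k : ℕ) :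
    R g ((k + 1 : ℤ) * a) := by
  induction k with
  | zero => simpa using ha
  | succ k ih =>
    have := R_add ih ha
    convert this using 1
    push_cast; ring

lemma R_zero {n : ℕ} {g : (Fin n → Bool) → ℂ} {a b : ℤ} (ha : R g a) (hb : R g b)
    (h1 : a ≤ 0) (h2 : 0 ≤ b) : R g 0 := by
  rcases h1.eq_or_lt with rfl | h1
  · exact ha
  rcases h2.eq_or_lt with rfl | h2
  · exact hb
  have x := R_add (R_mul ha (b - 1).toNat) (R_mul hb (-a - 1).toNat)
  convert x using 1
  rw [Int.toNat_of_nonneg (by omega), Int.toNat_of_nonneg (by omega)]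
  ring

lemma not_R_zero {n : ℕ} {g : (Fin n → Bool) → ℂ}
    (H : ∀ h : (Fin 0 → Bool) → ℂ, DClosure n g 0 h → h (fun i => i.elim0) = 0) :
    ¬ R g 0 := by
  rintro ⟨m, F, y, hF, hy, hw⟩
  have h1 := S_zero H m F hF y hw
  have h2 := S_zero H _ _ (DClosure.tensor hF hF) (Fin.append y (fun i => !y i))
    (by rw [sw_add]; simp only [Fin.append_left, Fin.append_right, sw_not]; simp [hw])
  simp only [S, tensorSig, Fin.append_left, Fin.append_right, Bool.not_not] at h1 h2
  have h3 : F y * F y = 0 := by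
    linear_combination F y * h1 - (1 / 2) * h2
  exact hy (mul_self_eq_zero.mp h3)

end VanSig

/-- every arity-0 signature (scalar) in the `≠₂`-diagram closure
of `g` equals `0` if and only if `g` is an `EO>` signature (every support
string has strictly more `1`s than `0`s) or an `EO<` signature (every support
string has strictly fewer `1`s than `0`s).  This characterizes the vanishing
signatures `f` via `g = K⁻¹f`. -/
theorem stmt5 {n : ℕ} (g : (Fin n → Bool) → ℂ) :
    (∀ h : (Fin 0 → Bool) → ℂ, DClosure n g 0 h → h (fun i => i.elim0) = 0) ↔
      ((∀ α, g α ≠ 0 → wt0 α < wt1 α) ∨ (∀ α, g α ≠ 0 → wt1 α < wt0 α)) := by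
  constructor
  · intro H
    by_contra hc
    rw [not_or] at hc
    obtain ⟨h1, h2⟩ := hc
    push Not at h1 h2
    obtain ⟨α, hα, wα⟩ := h1
    obtain ⟨β, hβ, wβ⟩ := h2
    refine VanSig.not_R_zero H (VanSig.R_zero ⟨n, g, α, DClosure.base, hα, rfl⟩
      ⟨n, g, β, DClosure.base, hβ, rfl⟩ ?_ ?_)
    · rw [VanSig.sw_eq]; omega
    · rw [VanSig.sw_eq]; omega
  · rintro (hg | hg) h hh
    · by_contra hc
      have := VanSig.pos_of_closure (fun α hα => by
        have := hg α hα
        rw [VanSig.sw_eq]; omega) hh _ hc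
      simp [VanSig.sw] at this
    · by_contra hc
      have := VanSig.neg_of_closure (fun α hα => by
        have := hg α hα
        rw [VanSig.sw_eq]; omega) hh _ hc
      simp [VanSig.sw] at this
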